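/- arXiv:1210.2412 — 3 statements merged into one kernel-verified Lean document; each statement's English description precedes it below -/
import Mathlib

section
/- If labeled posets (P,ω) and (Q,τ) satisfy (P,ω) ~ (Q,τ), then jump(P,ω) = jump(Q,τ): the maximum jump of an element of (P,ω) equals that of (Q,τ), and for each i the number of elements of (P,ω) of jump i equals the number of elements of (Q,τ) of jump i. -/
/-- A labeling of a finite poset: a bijection onto `{1, …, n}`. -/
def IsLabeling {α : Type*} (ω : α → ℕ) : Prop :=
  Set.BijOn ω Set.univ (Set.Icc 1 (Nat.card α))

/-- `f` is a `(P,ω)`-partition. -/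
def IsPtn {α : Type*} [PartialOrder α] (ω : α → ℕ) (f : α → ℕ) : Prop :=
  (∀ a, 1 ≤ f a) ∧ (∀ a b : α, a ≤ b → f a ≤ f b) ∧
    (∀ a b : α, a ≤ b → ω b < ω a → f a < f b)

/-- The number of `(P,ω)`-partitions of weight `w`. -/
noncomputable def ptnCount {α : Type*} [PartialOrder α] (ω : α → ℕ) (w : ℕ →₀ ℕ) : ℕ :=
  Set.ncard {f : α → ℕ | IsPtn ω f ∧ ∀ m : ℕ, 1 ≤ m → (f ⁻¹' {m}).ncard = w m}

/-- `(P,ω) ~ (Q,τ)`: equality of the `(P,ω)`-partition generating functions. -/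
def KEq {α β : Type*} [PartialOrder α] [PartialOrder β] (ω : α → ℕ) (τ : β → ℕ) : Prop :=
  ∀ w : ℕ →₀ ℕ, ptnCount ω w = ptnCount τ w

/-- `l` is a saturated chain from `b` down to a minimal element: `l = [c₀, c₁, …, c_k]` with
`c₀ = b`, each `c_{i+1} ⋖ c_i` a covering relation, and `c_k` minimal. -/
def IsSatDownChain {α : Type*} [PartialOrder α] (b : α) (l : List α) : Prop :=
  l.head? = some b ∧ List.Chain' (fun x y => y ⋖ x) l ∧
    ∃ m, l.getLast? = some m ∧ IsMin m

/-- The number of strict edges of a saturated chain `l = [c₀, …, c_k]`: the number of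
indices `i` with `ω c_{i+1} > ω c_i` (the covering edge `c_{i+1} ⋖ c_i` being strict). -/
def strictEdgeCount {α : Type*} (ω : α → ℕ) (l : List α) : ℕ :=
  ((l.zip l.tail).filter fun p => decide (ω p.1 < ω p.2)).length

/-- The jump of `b` in `(P,ω)`: the maximum number of strict edges on a saturated chain
from `b` down to a minimal element. -/
noncomputable def jump {α : Type*} [PartialOrder α] (ω : α → ℕ) (b : α) : ℕ :=
  sSup {k : ℕ | ∃ l : List α, IsSatDownChain b l ∧ strictEdgeCount ω l = k}

theorem ncard_lt_succ {α : Type*} [Finite α] (f : α → ℕ) (k : ℕ) :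
    {a | f a < k + 1}.ncard = {a | f a < k}.ncard + {a | f a = k}.ncard := by
  rw [← Set.ncard_union_eq]
  · congr 1
    ext a
    simp only [Set.mem_ofPred_eq, Set.mem_union]
    omega
  · rw [Set.disjoint_left]
    intro a ha hb
    simp only [Set.mem_ofPred_eq] at ha hb
    omega

theorem ncard_lt_eq_of_ncard_eq {α β : Type*} [Finite α] [Finite β] (f : α → ℕ) (g : β → ℕ)
    (h : ∀ i, {a | f a = i}.ncard = {b | g b = i}.ncard) (k : ℕ) :
    {a | f a < k}.ncard = {b | g b < k}.ncard := by
  induction k with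
  | zero => simp
  | succ k ih => rw [ncard_lt_succ, ncard_lt_succ, ih, h]

theorem strictEdgeCount_cons_cons {α : Type*} (ω : α → ℕ) (x y : α) (l : List α) :
    strictEdgeCount ω (x :: y :: l) =
      strictEdgeCount ω (y :: l) + if ω x < ω y then 1 else 0 := by
  unfold strictEdgeCount
  by_cases h : ω x < ω y <;> simp [h]

theorem IsPtn.strictEdgeCount_lt {α : Type*} [PartialOrder α] {ω f : α → ℕ} (hf : IsPtn ω f)
    (l : List α) (b : α) (hl : List.IsChain (fun x y => y ⋖ x) (b :: l)) :
    strictEdgeCount ω (b :: l) < f b := by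
  induction l generalizing b with
  | nil => simpa [strictEdgeCount] using Nat.lt_of_lt_of_le Nat.zero_lt_one (hf.1 b)
  | cons c l ih =>
    rw [List.isChain_cons_cons] at hl
    have h := ih c hl.2
    rw [strictEdgeCount_cons_cons]
    split_ifs with hlt
    · have := hf.2.2 c b hl.1.le hlt
      omega
    · have := hf.2.1 c b hl.1.le
      omega

theorem IsPtn.strictEdgeCount_lt_of_isSatDownChain {α : Type*} [PartialOrder α] {ω f : α → ℕ}
    (hf : IsPtn ω f) {l : List α} {b : α} (hl : IsSatDownChain b l) :
    strictEdgeCount ω l < f b := by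
  obtain ⟨hhead, hchain, -⟩ := hl
  cases l with
  | nil => simp at hhead
  | cons c l =>
    obtain rfl : c = b := by simpa using hhead
    exact hf.strictEdgeCount_lt l c hchain

theorem isPtn_ncard_Iic {α : Type*} [PartialOrder α] [Finite α] (ω : α → ℕ) :
    IsPtn ω fun a => (Set.Iic a).ncard := by
  refine ⟨fun a => ?_, fun a b hab => ?_, fun a b hab hlt => ?_⟩
  · exact (Set.ncard_pos).2 ⟨a, le_refl a⟩
  · exact Set.ncard_le_ncard (Set.Iic_subset_Iic.2 hab)
  · have hne : a ≠ b := by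
      rintro rfl
      exact lt_irrefl _ hlt
    exact Set.ncard_lt_ncard (Set.Iic_ssubset_Iic.2 (lt_of_le_of_ne hab hne))

theorem IsSatDownChain.cons {α : Type*} [PartialOrder α] {a b : α} {l : List α}
    (hl : IsSatDownChain a l) (hab : a ⋖ b) : IsSatDownChain b (b :: l) := by
  obtain ⟨hhead, hchain, m, hm, hmin⟩ := hl
  cases l with
  | nil => simp at hhead
  | cons c l =>
    obtain rfl : c = a := by simpa using hhead
    exact ⟨rfl, List.isChain_cons_cons.2 ⟨hab, hchain⟩, m, by simpa using hm, hmin⟩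

theorem exists_isSatDownChain {α : Type*} [PartialOrder α] [Finite α] (b : α) :
    ∃ l, IsSatDownChain b l := by
  induction b using WellFoundedLT.induction with
  | ind b ih =>
    by_cases hb : IsMin b
    · exact ⟨[b], rfl, List.isChain_singleton b, b, rfl, hb⟩
    · obtain ⟨c, hc⟩ := exists_covBy_of_wellFoundedGT hb
      obtain ⟨l, hl⟩ := ih c hc.lt
      exact ⟨b :: l, hl.cons hc⟩

theorem bddAbove_strictEdgeCount {α : Type*} [PartialOrder α] [Finite α] (ω : α → ℕ) (b : α) :
    BddAbove {k : ℕ | ∃ l : List α, IsSatDownChain b l ∧ strictEdgeCount ω l = k} := by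
  refine ⟨(Set.Iic b).ncard, ?_⟩
  rintro k ⟨l, hl, rfl⟩
  exact ((isPtn_ncard_Iic ω).strictEdgeCount_lt_of_isSatDownChain hl).le

theorem exists_strictEdgeCount_eq_jump {α : Type*} [PartialOrder α] [Finite α] (ω : α → ℕ)
    (b : α) : ∃ l : List α, IsSatDownChain b l ∧ strictEdgeCount ω l = jump ω b := by
  obtain ⟨l, hl⟩ := exists_isSatDownChain b
  exact Nat.sSup_mem (s := {k | ∃ l : List α, IsSatDownChain b l ∧ strictEdgeCount ω l = k})
    ⟨_, l, hl, rfl⟩ (bddAbove_strictEdgeCount ω b)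

theorem IsPtn.jump_lt {α : Type*} [PartialOrder α] [Finite α] {ω f : α → ℕ} (hf : IsPtn ω f)
    (b : α) : jump ω b < f b := by
  obtain ⟨l, hl, hj⟩ := exists_strictEdgeCount_eq_jump ω b
  exact hj ▸ hf.strictEdgeCount_lt_of_isSatDownChain hl

theorem jump_add_le_of_covBy {α : Type*} [PartialOrder α] [Finite α] (ω : α → ℕ) {a b : α}
    (hab : a ⋖ b) : (jump ω a + if ω b < ω a then 1 else 0) ≤ jump ω b := by
  obtain ⟨l, hl, hj⟩ := exists_strictEdgeCount_eq_jump ω a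
  refine le_csSup (bddAbove_strictEdgeCount ω b) ⟨b :: l, hl.cons hab, ?_⟩
  cases l with
  | nil => simp [IsSatDownChain] at hl
  | cons c l =>
    obtain rfl : c = a := by simpa using hl.1
    rw [strictEdgeCount_cons_cons, hj]

/-- The jump function, shifted to be positive, is the pointwise least partition. -/
theorem isPtn_jump_add_one {α : Type*} [PartialOrder α] [Finite α] (ω : α → ℕ) :
    IsPtn ω fun a => jump ω a + 1 := by
  have key (a b : α) (hab : a ≤ b) :
      jump ω a ≤ jump ω b ∧ (ω b < ω a → jump ω a < jump ω b) := by
    have := Fintype.ofFinite α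
    classical
    let _ : LocallyFiniteOrder α := Fintype.toLocallyFiniteOrder
    rw [le_iff_reflTransGen_covBy] at hab
    induction hab with
    | refl => simp
    | tail _ hbc ih =>
      have := jump_add_le_of_covBy ω hbc
      split_ifs at this <;> omega
  exact ⟨fun a => Nat.le_add_left _ _, fun a b hab => Nat.succ_le_succ (key a b hab).1,
    fun a b hab hlt => Nat.succ_lt_succ ((key a b hab).2 hlt)⟩

theorem finite_isPtn_weight {α : Type*} [PartialOrder α] [Finite α] (ω : α → ℕ) (w : ℕ →₀ ℕ) :
    {f : α → ℕ | IsPtn ω f ∧ ∀ m : ℕ, 1 ≤ m → (f ⁻¹' {m}).ncard = w m}.Finite := by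
  refine (Set.Finite.pi' fun _ : α => w.support.finite_toSet).subset ?_
  rintro f ⟨hf, hw⟩ a
  have h := hw (f a) (hf.1 a)
  have hpos : 0 < (f ⁻¹' {f a}).ncard := (Set.ncard_pos).2 ⟨a, rfl⟩
  simp only [Finset.mem_coe, Finsupp.mem_support_iff]
  omega

/-- Equivalent labeled posets have partitions of the same weights. -/
theorem KEq.exists_isPtn {α β : Type*} [PartialOrder α] [Finite α] [PartialOrder β]
    {ω : α → ℕ} {τ : β → ℕ} (h : KEq ω τ) {g : α → ℕ} (hg : IsPtn ω g) :
    ∃ f : β → ℕ, IsPtn τ f ∧ ∀ i, {b | f b = i}.ncard = {a | g a = i}.ncard := by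
  have hfin : (Function.support fun m => (g ⁻¹' {m}).ncard).Finite := by
    refine (Set.finite_range g).subset fun m hm => ?_
    obtain ⟨a, ha⟩ := Set.nonempty_of_ncard_ne_zero hm
    exact ⟨a, ha⟩
  have hne : ptnCount τ (Finsupp.ofSupportFinite _ hfin) ≠ 0 := by
    rw [← h]
    exact Set.ncard_ne_zero_of_mem (a := g) ⟨hg, fun _ _ => rfl⟩ (finite_isPtn_weight ω _)
  obtain ⟨f, hf, hw⟩ := Set.nonempty_of_ncard_ne_zero hne
  refine ⟨f, hf, fun i => ?_⟩
  rcases Nat.eq_zero_or_pos i with rfl | hi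
  · have h1 : {b | f b = 0} = ∅ := Set.eq_empty_of_forall_notMem fun b hb =>
      (Nat.pos_iff_ne_zero.1 (hf.1 b)) hb
    have h2 : {a | g a = 0} = ∅ := Set.eq_empty_of_forall_notMem fun a ha =>
      (Nat.pos_iff_ne_zero.1 (hg.1 a)) ha
    rw [h1, h2, Set.ncard_empty, Set.ncard_empty]
  · exact hw i hi

theorem KEq.ncard_jump_lt_le {α β : Type*} [PartialOrder α] [Finite α] [PartialOrder β]
    [Finite β] {ω : α → ℕ} {τ : β → ℕ} (h : KEq ω τ) (k : ℕ) :
    {a | jump ω a < k}.ncard ≤ {b | jump τ b < k}.ncard := by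
  obtain ⟨f, hf, hw⟩ := h.exists_isPtn (isPtn_jump_add_one ω)
  have heq := ncard_lt_eq_of_ncard_eq _ _ hw (k + 1)
  simp only [Nat.add_lt_add_iff_right] at heq
  rw [← heq]
  refine Set.ncard_le_ncard fun b hb => ?_
  have := hf.jump_lt b
  simp only [Set.mem_ofPred_eq] at hb ⊢
  omega

/-- If `(P,ω) ~ (Q,τ)` then `jump(P,ω) = jump(Q,τ)`: the maximum jumps agree, and for each
`i` the numbers of elements of jump `i` agree. -/
theorem stmt8 {α β : Type*} [PartialOrder α] [Fintype α] [PartialOrder β] [Fintype β]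
    (ω : α → ℕ) (τ : β → ℕ) (hω : IsLabeling ω) (hτ : IsLabeling τ)
    (h : KEq ω τ) :
    sSup (Set.range (jump ω)) = sSup (Set.range (jump τ)) ∧
    ∀ i : ℕ, {a : α | jump ω a = i}.ncard = {b : β | jump τ b = i}.ncard := by
  have hlt (k : ℕ) : {a | jump ω a < k}.ncard = {b | jump τ b < k}.ncard :=
    le_antisymm (h.ncard_jump_lt_le k) (KEq.ncard_jump_lt_le (fun w => (h w).symm) k)
  have heq (i : ℕ) : {a : α | jump ω a = i}.ncard = {b : β | jump τ b = i}.ncard := by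
    have h1 := hlt (i + 1)
    rw [ncard_lt_succ, ncard_lt_succ, hlt i] at h1
    exact Nat.add_left_cancel h1
  refine ⟨congrArg sSup (Set.ext fun i => ?_), heq⟩
  have hα : i ∈ Set.range (jump ω) ↔ 0 < {a : α | jump ω a = i}.ncard :=
    (Set.ncard_pos).symm
  have hβ : i ∈ Set.range (jump τ) ↔ 0 < {b : β | jump τ b = i}.ncard :=
    (Set.ncard_pos).symm
  rw [hα, hβ, heq]
end

section
/- Let (P,ω) and (Q,τ) be naturally labeled posets with (P,ω) ~ (Q,τ). Then (a) P and Q have the same number of minimal elements and the same number of maximal elements, and (b) P and Q have the same maximum chain length, i.e., the maximum cardinality of a chain in P equals the maximum cardinality of a chain in Q. -/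
/-- `(P,ω)` is naturally labeled: `a ≤ b` implies `ω a ≤ ω b`. -/
def NatLabeled {α : Type*} [PartialOrder α] (ω : α → ℕ) : Prop :=
  ∀ a b : α, a ≤ b → ω a ≤ ω b

/-- The maximum cardinality of a chain in the poset `α`. -/
noncomputable def maxChainLength (α : Type*) [PartialOrder α] : ℕ :=
  sSup {k : ℕ | ∃ s : Finset α, IsChain (· ≤ ·) (s : Set α) ∧ s.card = k}

open Finset

section LowerFinset

variable {α : Type*} [PartialOrder α]

/-- The finite lower sets of a poset. -/
abbrev LowerFinset (α : Type*) [PartialOrder α] : Type _ :=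
  {s : Finset α // IsLowerSet (s : Set α)}

/-- `K` is obtained from `L` by deleting some maximal elements of `L`. -/
def IsPeel (K L : LowerFinset α) : Prop :=
  K.1 ⊆ L.1 ∧ ∀ a ∈ L.1, a ∉ K.1 → ∀ b ∈ L.1, a ≤ b → b = a

/-- The empty lower set. -/
def emptyLower (α : Type*) [PartialOrder α] : LowerFinset α :=
  ⟨∅, by simp [isLowerSet_empty]⟩

/-- The whole poset as a lower set. -/
def fullLower (α : Type*) [PartialOrder α] [Fintype α] : LowerFinset α :=
  ⟨univ, by simp [isLowerSet_univ]⟩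

open scoped Classical in
/-- The zeta matrix of the lattice of lower sets. -/
noncomputable def zetaMatrix (α : Type*) [PartialOrder α] :
    Matrix (LowerFinset α) (LowerFinset α) ℤ :=
  Matrix.of fun K L => if K.1 ⊆ L.1 then 1 else 0

open scoped Classical in
/-- The Möbius matrix of the lattice of lower sets. -/
noncomputable def moebiusMatrix (α : Type*) [PartialOrder α] :
    Matrix (LowerFinset α) (LowerFinset α) ℤ :=
  Matrix.of fun K L => if IsPeel K L then (-1) ^ #(L.1 \ K.1) else 0

variable [Fintype α]

omit [Fintype α] in
open scoped Classical in
theorem exists_maximal_notMem {K L : LowerFinset α} (hKL : K.1 ⊆ L.1) (hne : K ≠ L) :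
    ∃ a ∈ L.1, a ∉ K.1 ∧ ∀ b ∈ L.1, a ≤ b → b = a := by
  have hn : (L.1 \ K.1).Nonempty := by
    rw [sdiff_nonempty]
    exact fun h => hne (Subtype.ext (hKL.antisymm h))
  obtain ⟨a, ha⟩ := (L.1 \ K.1).exists_maximal hn
  have ha' := mem_sdiff.1 ha.1
  refine ⟨a, ha'.1, ha'.2, fun b hb hab => ?_⟩
  have hbK : b ∉ K.1 := fun h => ha'.2 (K.2 hab h)
  exact (ha.2 (mem_sdiff.2 ⟨hb, hbK⟩) hab).antisymm hab

open scoped Classical in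
theorem zetaMatrix_mul_moebiusMatrix : zetaMatrix α * moebiusMatrix α = 1 := by
  ext I L
  rw [Matrix.mul_apply]
  have hsum : ∑ K, zetaMatrix α I K * moebiusMatrix α K L =
      ∑ K : LowerFinset α with I.1 ⊆ K.1 ∧ IsPeel K L, (-1 : ℤ) ^ #(L.1 \ K.1) := by
    rw [sum_filter]
    refine sum_congr rfl fun K _ => ?_
    simp only [zetaMatrix, moebiusMatrix, Matrix.of_apply, ite_and, ite_mul, one_mul, zero_mul]
  rw [hsum]
  by_cases hIL : I.1 ⊆ L.1
  · set T : Finset α := {a ∈ L.1 | a ∉ I.1 ∧ ∀ b ∈ L.1, a ≤ b → b = a} with hT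
    have key : ∑ K : LowerFinset α with I.1 ⊆ K.1 ∧ IsPeel K L, (-1 : ℤ) ^ #(L.1 \ K.1) =
        ∑ S ∈ T.powerset, (-1 : ℤ) ^ #S := by
      refine sum_bij (fun K _ => L.1 \ K.1) ?_ ?_ ?_ ?_
      · intro K hK
        simp only [mem_filter, mem_univ, true_and] at hK
        rw [mem_powerset]
        intro a ha
        rw [mem_sdiff] at ha
        simp only [hT, mem_filter]
        exact ⟨ha.1, fun h => ha.2 (hK.1 h), hK.2.2 a ha.1 ha.2⟩
      · intro K hK K' hK' h
        simp only [mem_filter, mem_univ, true_and] at hK hK'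
        apply Subtype.ext
        rw [← Finset.sdiff_sdiff_eq_self hK.2.1, ← Finset.sdiff_sdiff_eq_self hK'.2.1, h]
      · intro S hS
        rw [mem_powerset] at hS
        have hSL : S ⊆ L.1 := fun a ha => (mem_filter.1 (hS ha)).1
        refine ⟨⟨L.1 \ S, ?_⟩, ?_, Finset.sdiff_sdiff_eq_self hSL⟩
        · intro a b hba ha
          simp only [coe_sdiff, Set.mem_sdiff, mem_coe] at ha ⊢
          have hbL : b ∈ L.1 := L.2 hba ha.1
          refine ⟨hbL, fun hbS => ha.2 ?_⟩
          rw [(mem_filter.1 (hS hbS)).2.2 a ha.1 hba]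
          exact hbS
        · simp only [mem_filter, mem_univ, true_and]
          refine ⟨fun a ha => mem_sdiff.2 ⟨hIL ha, fun h => (mem_filter.1 (hS h)).2.1 ha⟩,
            sdiff_subset, fun a haL ha => ?_⟩
          have haS : a ∈ S := by
            by_contra h
            exact ha (mem_sdiff.2 ⟨haL, h⟩)
          exact (mem_filter.1 (hS haS)).2.2
      · intro K _
        rfl
    rw [key, sum_powerset_neg_one_pow_card, Matrix.one_apply]
    by_cases hne : I = L
    · subst hne
      have : T = ∅ := by
        rw [hT, filter_eq_empty_iff]
        exact fun a ha h => h.1 ha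
      simp [this]
    · obtain ⟨a, haL, haI, hmax⟩ := exists_maximal_notMem hIL hne
      have : T ≠ ∅ := ne_empty_of_mem (mem_filter.2 ⟨haL, haI, hmax⟩)
      simp [this, hne]
  · have hne : I ≠ L := by
      rintro rfl
      exact hIL subset_rfl
    rw [Matrix.one_apply, if_neg hne]
    refine sum_eq_zero fun K hK => ?_
    simp only [mem_filter, mem_univ, true_and] at hK
    exact absurd (hK.1.trans hK.2.1) hIL

open scoped Classical in
theorem card_add_le_of_one_sub_zetaMatrix_pow_ne_zero (k : ℕ) (K L : LowerFinset α)
    (h : ((1 - zetaMatrix α) ^ k) K L ≠ 0) : #K.1 + k ≤ #L.1 := by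
  induction k generalizing L with
  | zero =>
    rw [pow_zero, Matrix.one_apply] at h
    obtain rfl : K = L := by
      by_contra hne
      exact h (if_neg hne)
    simp
  | succ k ih =>
    rw [pow_succ, Matrix.mul_apply] at h
    obtain ⟨J, -, hJ⟩ := exists_ne_zero_of_sum_ne_zero h
    have h₁ := ih J (left_ne_zero_of_mul hJ)
    have h₂ := right_ne_zero_of_mul hJ
    rw [Matrix.sub_apply, Matrix.one_apply] at h₂
    by_cases hne : J = L
    · subst hne
      simp [zetaMatrix] at h₂
    · rw [if_neg hne] at h₂
      have hJL : J.1 ⊆ L.1 := by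
        by_contra hJL
        exact h₂ (by rw [zetaMatrix, Matrix.of_apply, if_neg hJL, sub_zero])
      have := card_lt_card (hJL.ssubset_of_ne fun h => hne (Subtype.ext h))
      omega

open scoped Classical in
theorem one_sub_zetaMatrix_pow_eq_zero :
    (1 - zetaMatrix α) ^ (Fintype.card α + 1) = 0 := by
  ext K L
  by_contra h
  have h₁ := card_add_le_of_one_sub_zetaMatrix_pow_ne_zero _ K L h
  have h₂ := card_le_univ L.1
  omega

open scoped Classical in
theorem moebiusMatrix_pow_eq_aeval (m : ℕ) :
    moebiusMatrix α ^ m = Polynomial.aeval (zetaMatrix α)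
      ((∑ i ∈ range (Fintype.card α + 1), (1 - Polynomial.X : Polynomial ℤ) ^ i) ^ m) := by
  have hgeom := mul_neg_geom_sum (1 - zetaMatrix α) (Fintype.card α + 1)
  rw [one_sub_zetaMatrix_pow_eq_zero, sub_sub_cancel, sub_zero] at hgeom
  have hinv : moebiusMatrix α * zetaMatrix α = 1 :=
    mul_eq_one_comm.1 zetaMatrix_mul_moebiusMatrix
  have hM := left_inv_eq_right_inv hinv hgeom
  simp only [map_pow, map_sum, map_sub, map_one, Polynomial.aeval_X]
  rw [← hM]

open scoped Classical in
theorem sign_mul_moebiusMatrix_pow_succ (m : ℕ) (L : LowerFinset α) :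
    (-1) ^ #L.1 * (moebiusMatrix α ^ (m + 1)) (emptyLower α) L =
      ∑ K : LowerFinset α with IsPeel K L,
        (-1) ^ #K.1 * (moebiusMatrix α ^ m) (emptyLower α) K := by
  rw [pow_succ, Matrix.mul_apply, mul_sum, sum_filter]
  refine sum_congr rfl fun K _ => ?_
  by_cases h : IsPeel K L
  · have hc : #(L.1 \ K.1) + #K.1 = #L.1 := card_sdiff_add_card_eq_card h.1
    have hsq : ((-1 : ℤ) ^ #(L.1 \ K.1)) * (-1) ^ #(L.1 \ K.1) = 1 := by
      rw [← mul_pow]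
      simp
    simp only [moebiusMatrix, Matrix.of_apply, if_pos h, ← hc, pow_add] at hsq ⊢
    linear_combination (-1 : ℤ) ^ #K.1 *
      ((Matrix.of fun K L : LowerFinset α =>
        if IsPeel K L then (-1 : ℤ) ^ #(L.1 \ K.1) else 0) ^ m) (emptyLower α) K * hsq
  · simp [moebiusMatrix, h]

open scoped Classical in
theorem sign_mul_moebiusMatrix_pow_nonneg (m : ℕ) (L : LowerFinset α) :
    0 ≤ (-1) ^ #L.1 * (moebiusMatrix α ^ m) (emptyLower α) L := by
  induction m generalizing L with
  | zero =>
    rw [pow_zero, Matrix.one_apply]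
    split_ifs with h
    · simp [← h, emptyLower]
    · simp
  | succ m ih =>
    rw [sign_mul_moebiusMatrix_pow_succ]
    exact sum_nonneg fun K _ => ih K

open scoped Classical in
theorem moebiusMatrix_pow_ne_zero_iff (m : ℕ) (L : LowerFinset α) :
    (-1) ^ #L.1 * (moebiusMatrix α ^ m) (emptyLower α) L ≠ 0 ↔
      ∀ s : Finset α, s ⊆ L.1 → IsChain (· ≤ ·) (s : Set α) → #s ≤ m := by
  induction m generalizing L with
  | zero =>
    rw [pow_zero, Matrix.one_apply]
    constructor
    · intro h s hs _
      obtain rfl : emptyLower α = L := by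
        by_contra hne
        simp [hne] at h
      simpa [emptyLower] using hs
    · intro h
      have hL : emptyLower α = L := by
        apply Subtype.ext
        refine (eq_empty_of_forall_notMem fun a ha => ?_).symm
        have := h {a} (by simpa using ha) (by simp)
        simp at this
      simp [hL]
  | succ m ih =>
    rw [sign_mul_moebiusMatrix_pow_succ, Ne,
      sum_eq_zero_iff_of_nonneg fun K _ => sign_mul_moebiusMatrix_pow_nonneg m K]
    push Not
    constructor
    · rintro ⟨K, hK, hne⟩ s hs hchain
      simp only [mem_filter, mem_univ, true_and] at hK
      have h₁ := (ih K).1 hne (s ∩ K.1) inter_subset_right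
        (hchain.mono (by simp))
      have h₂ : #(s \ K.1) ≤ 1 := by
        rw [card_le_one]
        intro a ha b hb
        rw [mem_sdiff] at ha hb
        rcases hchain.total ha.1 hb.1 with hab | hba
        · exact (hK.2 a (hs ha.1) ha.2 b (hs hb.1) hab).symm
        · exact hK.2 b (hs hb.1) hb.2 a (hs ha.1) hba
      have h₃ := card_inter_add_card_sdiff s K.1
      omega
    · intro h
      let K : LowerFinset α := ⟨{a ∈ L.1 | ∃ b ∈ L.1, a < b}, by
        intro a b hba ha
        simp only [coe_filter, Set.mem_ofPred_eq] at ha ⊢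
        obtain ⟨haL, c, hc, hac⟩ := ha
        exact ⟨L.2 hba haL, c, hc, hba.trans_lt hac⟩⟩
      have hKL : K.1 ⊆ L.1 := filter_subset _ _
      refine ⟨K, ?_, (ih K).2 fun s hs hchain => ?_⟩
      · simp only [mem_filter, mem_univ, true_and]
        refine ⟨hKL, fun a haL haK b hb hab => ?_⟩
        by_contra hne
        exact haK (mem_filter.2 ⟨haL, b, hb, lt_of_le_of_ne hab (Ne.symm hne)⟩)
      · rcases s.eq_empty_or_nonempty with rfl | hne
        · simp
        obtain ⟨a, ha⟩ := s.exists_maximal hne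
        obtain ⟨b, hb, hab⟩ := (mem_filter.1 (hs ha.1)).2
        have hlt : ∀ c ∈ s, c < b := fun c hc => by
          rcases hchain.total ha.1 hc with hac | hca
          · exact (ha.2 hc hac).trans_lt hab
          · exact hca.trans_lt hab
        have hbs : b ∉ s := fun hbs => lt_irrefl _ (hlt b hbs)
        have := h (insert b s) (insert_subset hb (hs.trans hKL)) (by
          rw [coe_insert]
          exact hchain.insert fun c hc _ => Or.inr (hlt c hc).le)
        rw [card_insert_of_notMem hbs] at this
        omega

open scoped Classical in
theorem maxChainLength_le_iff (m : ℕ) :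
    maxChainLength α ≤ m ↔
      (moebiusMatrix α ^ m) (emptyLower α) (fullLower α) ≠ 0 := by
  have h := moebiusMatrix_pow_ne_zero_iff m (fullLower α)
  rw [mul_ne_zero_iff_left (pow_ne_zero _ (by norm_num))] at h
  rw [h, maxChainLength]
  constructor
  · intro hle s _ hs
    have hbdd : BddAbove {k | ∃ s : Finset α, IsChain (· ≤ ·) (s : Set α) ∧ #s = k} := by
      refine ⟨Fintype.card α, ?_⟩
      rintro k ⟨t, -, rfl⟩
      exact card_le_univ t
    exact (le_csSup hbdd ⟨s, hs, rfl⟩).trans hle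
  · intro hle
    refine csSup_le ⟨0, ∅, by simp, rfl⟩ ?_
    rintro k ⟨s, hs, rfl⟩
    exact hle s (subset_univ s) hs

omit [PartialOrder α] in
theorem finite_setOf_forall_le (m : ℕ) : {f : α → ℕ | ∀ a, f a ≤ m}.Finite := by
  classical
  exact (Set.finite_Icc (0 : α → ℕ) fun _ => m).subset fun _ hf => Set.mem_Icc.2 ⟨fun _ => Nat.zero_le _, hf⟩

/-- The order-preserving maps to `{0, …, m}` with prescribed zero set. -/
def boundedMaps (m : ℕ) (L : Finset α) : Set (α → ℕ) :=
  {f | Monotone f ∧ (∀ a, f a ≤ m) ∧ ∀ a, f a = 0 ↔ a ∈ L}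

theorem finite_boundedMaps (m : ℕ) (L : Finset α) : (boundedMaps m L).Finite :=
  (finite_setOf_forall_le m).subset fun _ hf => hf.2.1

open scoped Classical in
theorem ncard_boundedMaps_succ (m : ℕ) (L : LowerFinset α) :
    (boundedMaps (m + 1) L.1).ncard =
      ∑ K : LowerFinset α with L.1 ⊆ K.1, (boundedMaps m K.1).ncard := by
  simp only [Set.ncard_eq_toFinset_card _ (finite_boundedMaps _ _)]
  rw [← card_sigma]
  refine card_bij' (fun f hf => (⟨⟨({a | f a ≤ 1} : Finset α), ?_⟩, fun a => f a - 1⟩ :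
      (_ : LowerFinset α) × (α → ℕ)))
    (fun p _ a => if a ∈ L.1 then 0 else p.2 a + 1) ?_ ?_ ?_ ?_
  · intro a b hba ha
    simp only [Set.Finite.mem_toFinset] at hf
    simp only [coe_filter, mem_univ, true_and, Set.mem_ofPred_eq] at ha ⊢
    exact (hf.1 hba).trans ha
  · intro f hf
    simp only [Set.Finite.mem_toFinset] at hf
    simp only [mem_sigma, mem_filter, mem_univ, true_and, Set.Finite.mem_toFinset]
    refine ⟨fun a ha => ?_, fun a b hab => Nat.sub_le_sub_right (hf.1 hab) 1,
      fun a => ?_, fun a => ?_⟩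
    · simp [(hf.2.2 a).2 ha]
    · have := hf.2.1 a
      dsimp only
      omega
    · simp only [mem_filter, mem_univ, true_and]
      omega
  · rintro ⟨K, g⟩ hg
    simp only [mem_sigma, mem_filter, mem_univ, true_and, Set.Finite.mem_toFinset] at hg ⊢
    obtain ⟨hLK, hmono, hle, hzero⟩ := hg
    refine ⟨fun a b hab => ?_, fun a => ?_, fun a => ?_⟩
    · by_cases ha : a ∈ L.1
      · simp [ha]
      · have hb : b ∉ L.1 := fun h => ha (L.2 hab h)
        simpa [ha, hb] using hmono hab
    · have := hle a
      dsimp only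
      split_ifs <;> omega
    · simp
  · intro f hf
    simp only [Set.Finite.mem_toFinset] at hf
    funext a
    have := hf.2.2 a
    dsimp only
    split_ifs with h
    · exact (this.2 h).symm
    · have : f a ≠ 0 := fun h' => h (this.1 h')
      omega
  · rintro ⟨K, g⟩ hg
    simp only [mem_sigma, mem_filter, mem_univ, true_and, Set.Finite.mem_toFinset] at hg
    obtain ⟨hLK, hmono, hle, hzero⟩ := hg
    have hg' : (fun a => (if a ∈ L.1 then 0 else g a + 1) - 1) = g := by
      funext a
      split_ifs with h
      · exact ((hzero a).2 (hLK h)).symm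
      · simp
    simp only [Sigma.mk.injEq, hg', heq_eq_eq, and_true]
    apply Subtype.ext
    ext a
    simp only [mem_filter, mem_univ, true_and, ← hzero a]
    split_ifs with h
    · simp [(hzero a).2 (hLK h)]
    · simp

open scoped Classical in
theorem zetaMatrix_pow_apply_fullLower (m : ℕ) (L : LowerFinset α) :
    (zetaMatrix α ^ m) L (fullLower α) = (boundedMaps m L.1).ncard := by
  induction m generalizing L with
  | zero =>
    rw [pow_zero, Matrix.one_apply]
    split_ifs with h
    · subst h
      have : boundedMaps 0 (fullLower α).1 = {fun _ => 0} := by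
        ext f
        simp only [boundedMaps, fullLower, Set.mem_ofPred_eq, mem_univ, iff_true,
          Set.mem_singleton_iff]
        refine ⟨fun hf => funext hf.2.2, ?_⟩
        rintro rfl
        exact ⟨monotone_const, fun _ => le_rfl, fun _ => rfl⟩
      simp [this]
    · have : boundedMaps 0 L.1 = ∅ := by
        refine Set.eq_empty_of_forall_notMem fun f hf => h (Subtype.ext ?_)
        exact eq_univ_of_forall fun a => (hf.2.2 a).1 (Nat.le_zero.1 (hf.2.1 a))
      simp [this]
  | succ m ih =>
    rw [pow_succ', Matrix.mul_apply, ncard_boundedMaps_succ, sum_filter]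
    push_cast
    refine sum_congr rfl fun K _ => ?_
    rw [ih]
    simp only [zetaMatrix, Matrix.of_apply, ite_mul, one_mul, zero_mul]

end LowerFinset

section Partitions

variable {α β : Type*} [PartialOrder α] [Fintype α] [PartialOrder β] [Fintype β]
  {ω : α → ℕ} {τ : β → ℕ}

omit [PartialOrder α] in
theorem ncard_fiber_ne_zero (f : α → ℕ) (a : α) : (f ⁻¹' {f a}).ncard ≠ 0 :=
  Set.ncard_ne_zero_of_mem (show a ∈ f ⁻¹' {f a} from rfl)

omit [Fintype α] in
theorem NatLabeled.isPtn_iff (hω : NatLabeled ω) (f : α → ℕ) :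
    IsPtn ω f ↔ (∀ a, 1 ≤ f a) ∧ Monotone f := by
  refine ⟨fun h => ⟨h.1, fun a b => h.2.1 a b⟩, fun h => ⟨h.1, fun a b hab => h.2 hab, ?_⟩⟩
  intro a b hab hlt
  exact absurd (hω a b hab) (not_le.2 hlt)

theorem finite_setOf_weight (w : ℕ →₀ ℕ) :
    {f : α → ℕ | IsPtn ω f ∧ ∀ m : ℕ, 1 ≤ m → (f ⁻¹' {m}).ncard = w m}.Finite := by
  refine (finite_setOf_forall_le (w.support.sup id)).subset fun f hf a => ?_
  refine le_sup (f := id) (Finsupp.mem_support_iff.2 ?_)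
  rw [← hf.2 (f a) (hf.1.1 a)]
  exact ncard_fiber_ne_zero f a

open scoped Classical in
theorem ncard_boundedMaps_empty (hω : NatLabeled ω) (m : ℕ) :
    (boundedMaps m (∅ : Finset α)).ncard =
      ∑ w ∈ (Icc 1 m).finsupp fun _ => range (Fintype.card α + 1), ptnCount ω w := by
  have hfib : ∀ (f : α → ℕ) (k : ℕ), (f ⁻¹' {k}).ncard ≤ Fintype.card α := fun f k => by
    rw [← Nat.card_eq_fintype_card]
    exact Set.ncard_le_card _
  let wt : (α → ℕ) → ℕ →₀ ℕ := fun f =>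
    Finsupp.onFinset (Icc 1 m) (fun k => if k ∈ Icc 1 m then (f ⁻¹' {k}).ncard else 0)
      fun k hk => by
        by_contra h
        simp [h] at hk
  rw [Set.ncard_eq_toFinset_card _ (finite_boundedMaps _ _),
    card_eq_sum_card_fiberwise (f := wt)
      (t := (Icc 1 m).finsupp fun _ => range (Fintype.card α + 1))]
  · refine sum_congr rfl fun w hw => ?_
    rw [ptnCount, Set.ncard_eq_toFinset_card _ (finite_setOf_weight w)]
    congr 1
    rw [mem_finsupp_iff] at hw
    have hw0 : ∀ k, k ∉ Icc 1 m → w k = 0 := fun k hk =>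
      Finsupp.notMem_support_iff.1 fun h => hk (hw.1 h)
    ext f
    simp only [mem_filter, Set.Finite.mem_toFinset, Set.mem_ofPred_eq, hω.isPtn_iff, boundedMaps,
      notMem_empty, iff_false]
    constructor
    · rintro ⟨⟨hmono, hle, hpos⟩, rfl⟩
      refine ⟨⟨fun a => Nat.one_le_iff_ne_zero.2 (hpos a), hmono⟩, fun k hk => ?_⟩
      by_cases hkm : k ≤ m
      · simp [wt, hk, hkm]
      · have : f ⁻¹' {k} = ∅ := by
          refine Set.eq_empty_of_forall_notMem fun a ha => hkm ?_
          rw [← show f a = k from ha]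
          exact hle a
        simp [wt, hkm, this]
    · rintro ⟨⟨hpos, hmono⟩, hk⟩
      refine ⟨⟨hmono, fun a => ?_, fun a => Nat.one_le_iff_ne_zero.1 (hpos a)⟩, ?_⟩
      · by_contra hle
        have h₁ := hk (f a) (hpos a)
        rw [hw0 _ (by simp [hle])] at h₁
        exact ncard_fiber_ne_zero f a h₁
      · ext k
        by_cases hkm : k ∈ Icc 1 m
        · simpa [wt, (mem_Icc.1 hkm).1, (mem_Icc.1 hkm).2] using hk k (mem_Icc.1 hkm).1
        · rw [hw0 k hkm]
          exact if_neg hkm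
  · intro f _
    rw [mem_coe, mem_finsupp_iff]
    refine ⟨Finsupp.support_onFinset_subset, fun k hk => ?_⟩
    simpa [wt, hk, Nat.lt_succ_iff, mem_Icc.1 hk] using hfib f k

theorem KEq.card_eq (hω : NatLabeled ω) (h : KEq ω τ) : Fintype.card α = Fintype.card β := by
  classical
  have h₁ : 0 < ptnCount ω (Finsupp.single 1 (Fintype.card α)) := by
    rw [ptnCount, Set.ncard_pos (finite_setOf_weight _)]
    refine ⟨fun _ => 1, (hω.isPtn_iff _).2 ⟨fun _ => le_rfl, monotone_const⟩, fun k hk => ?_⟩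
    by_cases h1 : k = 1
    · subst h1
      rw [Set.preimage_const_of_mem (Set.mem_singleton 1)]
      simp
    · rw [Set.preimage_const_of_notMem (fun h => h1 (Set.mem_singleton_iff.1 h).symm)]
      simp [Ne.symm h1]
  rw [h, ptnCount, Set.ncard_pos (finite_setOf_weight _)] at h₁
  obtain ⟨f, hf, hw⟩ := h₁
  have hf1 : f ⁻¹' {1} = Set.univ := by
    refine Set.eq_univ_of_forall fun b => ?_
    by_contra hb
    have h₂ := hw (f b) (hf.1 b)
    rw [Finsupp.single_eq_of_ne (by simpa using hb)] at h₂
    exact ncard_fiber_ne_zero f b h₂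
  have h₃ := hw 1 le_rfl
  rw [hf1, Set.ncard_univ, Nat.card_eq_fintype_card] at h₃
  simpa using h₃.symm

theorem maxChainLength_eq_of_KEq (hω : NatLabeled ω) (hτ : NatLabeled τ) (h : KEq ω τ) :
    maxChainLength α = maxChainLength β := by
  classical
  have hzeta : ∀ m, (zetaMatrix α ^ m) (emptyLower α) (fullLower α) =
      (zetaMatrix β ^ m) (emptyLower β) (fullLower β) := fun m => by
    rw [zetaMatrix_pow_apply_fullLower, zetaMatrix_pow_apply_fullLower]
    simp only [emptyLower]
    rw [ncard_boundedMaps_empty hω, ncard_boundedMaps_empty hτ, h.card_eq hω]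
    exact congrArg _ (sum_congr rfl fun w _ => h w)
  refine eq_of_forall_ge_iff fun m => ?_
  rw [maxChainLength_le_iff, maxChainLength_le_iff, moebiusMatrix_pow_eq_aeval,
    moebiusMatrix_pow_eq_aeval, h.card_eq hω, Polynomial.aeval_eq_sum_range,
    Polynomial.aeval_eq_sum_range, Matrix.sum_apply, Matrix.sum_apply]
  simp only [Matrix.smul_apply, hzeta]

omit [PartialOrder α] in
theorem weight_iff_exists_update [DecidableEq α] {i j : ℕ} (hi : 1 ≤ i) (hj : 1 ≤ j)
    (hij : i ≠ j) {f : α → ℕ} (hf : ∀ a, 1 ≤ f a) :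
    (∀ m : ℕ, 1 ≤ m → (f ⁻¹' {m}).ncard =
        (Finsupp.single i 1 + Finsupp.single j (Fintype.card α - 1) : ℕ →₀ ℕ) m) ↔
      ∃ a, Function.update (fun _ => j) a i = f := by
  constructor
  · intro h
    have h₁ := h i hi
    rw [Finsupp.add_apply, Finsupp.single_eq_same, Finsupp.single_eq_of_ne hij,
      add_zero, Set.ncard_eq_one] at h₁
    obtain ⟨a, ha⟩ := h₁
    refine ⟨a, funext fun x => ?_⟩
    have hx : f x = i ↔ x = a := by
      rw [← Set.mem_singleton_iff (a := x), ← ha]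
      rfl
    by_cases hxa : x = a
    · rw [hx.2 hxa, hxa, Function.update_self]
    · rw [Function.update_of_ne hxa]
      by_contra hne
      have h₂ := h (f x) (hf x)
      rw [Finsupp.add_apply, Finsupp.single_eq_of_ne (mt hx.1 hxa),
        Finsupp.single_eq_of_ne (Ne.symm hne)] at h₂
      exact ncard_fiber_ne_zero f x h₂
  · rintro ⟨a, rfl⟩ m -
    have hval : ∀ x, Function.update (fun _ => j) a i x = if x = a then i else j :=
      fun x => Function.update_apply _ _ _ _
    by_cases hmi : m = i
    · subst hmi
      have : Function.update (fun _ => j) a m ⁻¹' {m} = {a} := by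
        ext x
        rw [Set.mem_preimage, hval, Set.mem_singleton_iff, Set.mem_singleton_iff]
        split_ifs with h <;> simp [h, hij.symm]
      simp [this, Finsupp.single_eq_of_ne hij]
    · by_cases hmj : m = j
      · subst hmj
        have : Function.update (fun _ => m) a i ⁻¹' {m} = {a}ᶜ := by
          ext x
          rw [Set.mem_preimage, hval, Set.mem_compl_iff, Set.mem_singleton_iff,
            Set.mem_singleton_iff]
          split_ifs with h <;> simp [h, hij]
        rw [this, Set.ncard_compl, Set.ncard_singleton, Nat.card_eq_fintype_card]
        simp [Finsupp.single_eq_of_ne hmi]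
      · have : Function.update (fun _ => j) a i ⁻¹' {m} = ∅ := by
          ext x
          rw [Set.mem_preimage, hval, Set.mem_singleton_iff]
          split_ifs with h <;> simp [Ne.symm hmi, Ne.symm hmj]
        simp [this, Finsupp.single_eq_of_ne hmi, Finsupp.single_eq_of_ne hmj]

theorem ptnCount_single_add_single [DecidableEq α] (hω : NatLabeled ω) {i j : ℕ}
    (hi : 1 ≤ i) (hj : 1 ≤ j) (hij : i ≠ j) :
    ptnCount ω (Finsupp.single i 1 + Finsupp.single j (Fintype.card α - 1)) =
      {a : α | Monotone (Function.update (fun _ => j) a i)}.ncard := by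
  have hinj : Function.Injective fun a : α => Function.update (fun _ => j) a i := by
    intro a b hab
    by_contra hne
    have := congrFun hab a
    simp only [Function.update_self, Function.update_of_ne hne] at this
    exact hij this
  rw [ptnCount, ← Set.ncard_image_of_injective _ hinj]
  congr 1
  ext f
  simp only [Set.mem_ofPred_eq, Set.mem_image, hω.isPtn_iff]
  constructor
  · rintro ⟨⟨hpos, hmono⟩, hw⟩
    obtain ⟨a, rfl⟩ := (weight_iff_exists_update hi hj hij hpos).1 hw
    exact ⟨a, hmono, rfl⟩
  · rintro ⟨a, hmono, rfl⟩
    have hpos : ∀ x, 1 ≤ Function.update (fun _ => j) a i x := fun x => by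
      rw [Function.update_apply]
      split_ifs <;> assumption
    exact ⟨⟨hpos, hmono⟩, (weight_iff_exists_update hi hj hij hpos).2 ⟨a, rfl⟩⟩

omit [Fintype α] in
theorem monotone_update_lt_iff_isMin [DecidableEq α] {i j : ℕ} (hij : i < j) (a : α) :
    Monotone (Function.update (fun _ => j) a i) ↔ IsMin a := by
  constructor
  · intro h b hba
    have := h hba
    rw [Function.update_self, Function.update_apply] at this
    split_ifs at this with hb
    · exact hb.ge
    · omega
  · intro h x y hxy
    rw [Function.update_apply, Function.update_apply]
    split_ifs with hx hy hy
    · exact le_rfl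
    · exact hij.le
    · exact absurd ((h.eq_of_le (hy ▸ hxy))) hx
    · exact le_rfl

omit [Fintype α] in
theorem monotone_update_gt_iff_isMax [DecidableEq α] {i j : ℕ} (hij : j < i) (a : α) :
    Monotone (Function.update (fun _ => j) a i) ↔ IsMax a := by
  constructor
  · intro h b hab
    have := h hab
    rw [Function.update_self, Function.update_apply] at this
    split_ifs at this with hb
    · exact hb.le
    · omega
  · intro h x y hxy
    rw [Function.update_apply, Function.update_apply]
    split_ifs with hx hy hy
    · exact le_rfl
    · exact absurd ((h.eq_of_ge (hx ▸ hxy))) hy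
    · exact hij.le
    · exact le_rfl

theorem ncard_isMin_eq_of_KEq (hω : NatLabeled ω) (hτ : NatLabeled τ) (h : KEq ω τ) :
    {a : α | IsMin a}.ncard = {b : β | IsMin b}.ncard := by
  classical
  have hα := ptnCount_single_add_single hω (i := 1) (j := 2) (by simp) (by simp) (by simp)
  have hβ := ptnCount_single_add_single hτ (i := 1) (j := 2) (by simp) (by simp) (by simp)
  simp only [monotone_update_lt_iff_isMin one_lt_two] at hα hβ
  rw [← hα, ← hβ, h, h.card_eq hω]

theorem ncard_isMax_eq_of_KEq (hω : NatLabeled ω) (hτ : NatLabeled τ) (h : KEq ω τ) :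
    {a : α | IsMax a}.ncard = {b : β | IsMax b}.ncard := by
  classical
  have hα := ptnCount_single_add_single hω (i := 2) (j := 1) (by simp) (by simp) (by simp)
  have hβ := ptnCount_single_add_single hτ (i := 2) (j := 1) (by simp) (by simp) (by simp)
  simp only [monotone_update_gt_iff_isMax one_lt_two] at hα hβ
  rw [← hα, ← hβ, h, h.card_eq hω]

end Partitions

/-- If `(P,ω)` and `(Q,τ)` are naturally labeled and `(P,ω) ~ (Q,τ)`, then
(a) `P` and `Q` have the same number of minimal elements and the same number of maximal
elements, and (b) they have the same maximum chain length. -/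
theorem stmt9 {α β : Type*} [PartialOrder α] [Fintype α] [PartialOrder β] [Fintype β]
    (ω : α → ℕ) (τ : β → ℕ) (hω : IsLabeling ω) (hτ : IsLabeling τ)
    (hnatω : NatLabeled ω) (hnatτ : NatLabeled τ) (h : KEq ω τ) :
    {a : α | IsMin a}.ncard = {b : β | IsMin b}.ncard ∧
    {a : α | IsMax a}.ncard = {b : β | IsMax b}.ncard ∧
    maxChainLength α = maxChainLength β := by
  exact ⟨ncard_isMin_eq_of_KEq hnatω hnatτ h, ncard_isMax_eq_of_KEq hnatω hnatτ h,
    maxChainLength_eq_of_KEq hnatω hnatτ h⟩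
end

section
/- If labeled posets (P,ω) and (Q,τ) satisfy (P,ω) ~ (Q,τ), then the maximum cardinality of a weak convex subset of (P,ω) equals the maximum cardinality of a weak convex subset of (Q,τ), and likewise the maximum cardinalities of their strict convex subsets are equal. -/
/-- The maximum cardinality of a weak convex subset of `(P,ω)`: a convex (order-connected)
subset all of whose covering edges are weak (`a ⋖ b` implies `ω a < ω b`). -/
noncomputable def maxWeakConvex {α : Type*} [PartialOrder α] (ω : α → ℕ) : ℕ :=
  sSup {k : ℕ | ∃ s : Set α, s.OrdConnected ∧
    (∀ a ∈ s, ∀ b ∈ s, a ⋖ b → ω a < ω b) ∧ s.ncard = k}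

/-- The maximum cardinality of a strict convex subset of `(P,ω)`: a convex subset all of
whose covering edges are strict (`a ⋖ b` implies `ω a > ω b`). -/
noncomputable def maxStrictConvex {α : Type*} [PartialOrder α] (ω : α → ℕ) : ℕ :=
  sSup {k : ℕ | ∃ s : Set α, s.OrdConnected ∧
    (∀ a ∈ s, ∀ b ∈ s, a ⋖ b → ω b < ω a) ∧ s.ncard = k}

section Convex

variable {α : Type*} [PartialOrder α] [Finite α]

theorem rel_of_lt_of_rel_covBy {R : α → α → Prop} (hR : ∀ a b c, R a b → R b c → R a c)
    {s : Set α} (hs : s.OrdConnected) (hcov : ∀ a ∈ s, ∀ b ∈ s, a ⋖ b → R a b)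
    {a b : α} (ha : a ∈ s) (hb : b ∈ s) (hab : a < b) : R a b := by
  induction b using WellFoundedLT.induction with
  | ind b ih =>
    obtain ⟨c, hac, hcb⟩ := exists_le_covBy_of_lt hab
    have hc : c ∈ s := hs.out ha hb ⟨hac, hcb.le⟩
    rcases hac.eq_or_lt with rfl | hac
    · exact hcov _ hc _ hb hcb
    · exact hR _ _ _ (ih c hcb.lt hc hac) (hcov _ hc _ hb hcb)

/-- Every convex subset is a fiber of a positive monotone map that is strictly monotone outside
the subset. -/
theorem exists_monotone_fiber_eq {s : Set α} (hs : s.OrdConnected) :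
    ∃ (f : α → ℕ) (m : ℕ), 1 ≤ m ∧ (∀ a, 1 ≤ f a) ∧ (∀ a b, a ≤ b → f a ≤ f b) ∧
      (∀ a b, a < b → f a = f b → a ∈ s ∧ b ∈ s) ∧ f ⁻¹' {m} = s := by
  classical
  set g : α → ℕ := fun a => (Set.Iic a).ncard with hg
  have hg1 : ∀ a, 1 ≤ g a := fun a => (Set.ncard_pos (Set.toFinite _)).2 ⟨a, le_refl a⟩
  have hgn : ∀ a, g a ≤ Nat.card α := fun a => Set.ncard_le_card _
  have hgm : ∀ a b, a < b → g a < g b := fun a b hab =>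
    Set.ncard_lt_ncard (Set.Iic_ssubset_Iic.2 hab) (Set.toFinite _)
  set N := Nat.card α + 1
  set f : α → ℕ := fun a => if a ∈ s then N else if ∃ y ∈ s, a ≤ y then g a else N + g a with hf
  have key : ∀ a b, a < b → f a ≤ f b ∧ (f a = f b → a ∈ s ∧ b ∈ s) := by
    intro a b hab
    have h1 := hg1 a
    have h2 := hgn a
    have h3 := hgm a b hab
    have h4 := hgn b
    by_cases ha : a ∈ s <;> by_cases hb : b ∈ s
    · simp [hf, ha, hb]
    · have : ¬ ∃ y ∈ s, b ≤ y := fun ⟨y, hy, hby⟩ => hb (hs.out ha hy ⟨hab.le, hby⟩)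
      simp only [hf, ha, hb, this, if_true, if_false]
      omega
    · have : ∃ y ∈ s, a ≤ y := ⟨b, hb, hab.le⟩
      simp only [hf, ha, hb, this, if_true, if_false]
      omega
    · by_cases hb' : ∃ y ∈ s, b ≤ y
      · have : ∃ y ∈ s, a ≤ y := hb'.imp fun y hy => ⟨hy.1, hab.le.trans hy.2⟩
        simp only [hf, ha, hb, hb', this, if_true, if_false]
        omega
      · simp only [hf, ha, hb, hb', if_false]
        split_ifs <;> omega
  refine ⟨f, N, by omega, ?_, ?_, fun a b hab => (key a b hab).2, ?_⟩
  · intro a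
    have := hg1 a
    simp only [hf]
    split_ifs <;> omega
  · intro a b hab
    rcases hab.eq_or_lt with rfl | hab
    · exact le_rfl
    · exact (key a b hab).1
  · ext a
    have h1 := hg1 a
    have h2 := hgn a
    simp only [hf, Set.mem_preimage, Set.mem_singleton_iff]
    split_ifs with h h' <;> simp only [h, iff_false] <;> omega

end Convex

section Weight

variable {α : Type*} [Fintype α]

theorem exists_weight (f : α → ℕ) : ∃ w : ℕ →₀ ℕ, ∀ m, (f ⁻¹' {m}).ncard = w m := by
  classical
  refine ⟨Finsupp.onFinset (Finset.univ.image f) (fun m => (f ⁻¹' {m}).ncard) ?_, fun _ => rfl⟩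
  intro m hm
  obtain ⟨a, ha⟩ := Set.nonempty_of_ncard_ne_zero hm
  exact Finset.mem_image.2 ⟨a, Finset.mem_univ _, ha⟩

theorem card_eq_sum_weight {f : α → ℕ} {w : ℕ →₀ ℕ} (hf : ∀ a, 1 ≤ f a)
    (hw : ∀ m : ℕ, 1 ≤ m → (f ⁻¹' {m}).ncard = w m) :
    Fintype.card α = ∑ m ∈ w.support.erase 0, w m := by
  classical
  rw [← Finset.card_univ, Finset.card_eq_sum_card_fiberwise (f := f) (t := w.support.erase 0)]
  · refine Finset.sum_congr rfl fun m hm => ?_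
    rw [← hw m (Nat.one_le_iff_ne_zero.2 (Finset.ne_of_mem_erase hm)), ← Set.ncard_coe_finset]
    congr 1
    ext a
    simp
  · intro a _
    rw [Finset.mem_coe, Finset.mem_erase, Finsupp.mem_support_iff, ← hw _ (hf a)]
    exact ⟨Nat.one_le_iff_ne_zero.1 (hf a), Set.ncard_ne_zero_of_mem (a := a) rfl (Set.toFinite _)⟩

end Weight

section Weak

variable {α : Type*} [PartialOrder α] [Fintype α]

theorem finite_ptn (ω : α → ℕ) (w : ℕ →₀ ℕ) :
    {f : α → ℕ | IsPtn ω f ∧ ∀ m : ℕ, 1 ≤ m → (f ⁻¹' {m}).ncard = w m}.Finite := by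
  refine (Set.Finite.pi fun _ : α => w.support.finite_toSet).subset ?_
  rintro f ⟨hf, hw⟩ a -
  rw [Finset.mem_coe, Finsupp.mem_support_iff, ← hw _ (hf.1 a)]
  exact Set.ncard_ne_zero_of_mem (a := a) rfl (Set.toFinite _)

theorem ptnCount_ne_zero_iff {ω : α → ℕ} {w : ℕ →₀ ℕ} :
    ptnCount ω w ≠ 0 ↔ ∃ f, IsPtn ω f ∧ ∀ m : ℕ, 1 ≤ m → (f ⁻¹' {m}).ncard = w m := by
  rw [ptnCount, ← Nat.pos_iff_ne_zero, Set.ncard_pos (finite_ptn ω w)]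
  rfl

theorem exists_weak_convex_iff {ω : α → ℕ} (hω : Function.Injective ω) (k : ℕ) :
    (∃ s : Set α, s.OrdConnected ∧ (∀ a ∈ s, ∀ b ∈ s, a ⋖ b → ω a < ω b) ∧ s.ncard = k) ↔
      ∃ (w : ℕ →₀ ℕ) (m : ℕ), 1 ≤ m ∧ ptnCount ω w ≠ 0 ∧ w m = k := by
  constructor
  · rintro ⟨s, hs, hcov, rfl⟩
    obtain ⟨f, m, hm, h1, hmono, hstrict, hfib⟩ := exists_monotone_fiber_eq hs
    obtain ⟨w, hw⟩ := exists_weight f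
    refine ⟨w, m, hm, ptnCount_ne_zero_iff.2 ⟨f, ⟨h1, hmono, ?_⟩, fun m _ => hw m⟩, ?_⟩
    · intro a b hab hba
      have hlt : a < b := lt_of_le_of_ne hab (by rintro rfl; exact lt_irrefl _ hba)
      refine lt_of_le_of_ne (hmono a b hab) fun he => ?_
      obtain ⟨ha, hb⟩ := hstrict a b hlt he
      exact lt_asymm hba (rel_of_lt_of_rel_covBy (R := fun a b => ω a < ω b)
        (fun _ _ _ => lt_trans) hs hcov ha hb hlt)
    · rw [← hw, hfib]
  · rintro ⟨w, m, hm, hw, rfl⟩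
    obtain ⟨f, ⟨h1, hmono, hstrict⟩, hw⟩ := ptnCount_ne_zero_iff.1 hw
    refine ⟨f ⁻¹' {m}, ⟨?_⟩, ?_, hw m hm⟩
    · rintro a ha b hb c ⟨hac, hcb⟩
      exact le_antisymm ((hmono _ _ hcb).trans_eq hb) (ha.symm.trans_le (hmono _ _ hac))
    · intro a ha b hb hab
      by_contra hlt
      have hba : ω b < ω a := lt_of_le_of_ne (not_lt.1 hlt) fun he => hab.lt.ne (hω he.symm)
      exact (hstrict a b hab.le hba).ne (ha.trans hb.symm)

theorem card_eq_of_kEq {β : Type*} [PartialOrder β] [Fintype β] {ω : α → ℕ} {τ : β → ℕ}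
    (h : KEq ω τ) : Fintype.card α = Fintype.card β := by
  classical
  obtain ⟨f, -, -, h1, hmono, hstrict, -⟩ :=
    exists_monotone_fiber_eq (α := α) Set.ordConnected_empty
  obtain ⟨w, hw⟩ := exists_weight f
  have hf : IsPtn ω f := ⟨h1, hmono, fun a b hab hba =>
    lt_of_le_of_ne (hmono a b hab) fun he =>
      (hstrict a b (lt_of_le_of_ne hab (by rintro rfl; exact lt_irrefl _ hba)) he).1⟩
  obtain ⟨g, hg, hw'⟩ := ptnCount_ne_zero_iff.1
    (h w ▸ ptnCount_ne_zero_iff.2 ⟨f, hf, fun m _ => hw m⟩)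
  rw [card_eq_sum_weight h1 fun m _ => hw m, card_eq_sum_weight hg.1 hw']

end Weak

section LinearExtension

variable {α : Type*} {n : ℕ}

theorem exists_sorting_equiv [Fintype α] (hn : Fintype.card α = n) {L : Type*} [LinearOrder L]
    {key : α → L} (hkey : Function.Injective key) :
    ∃ π : α ≃ Fin n, ∀ i j, i < j → key (π.symm i) < key (π.symm j) := by
  classical
  have hc : (Finset.univ.image key).card = n := by
    rw [Finset.card_image_of_injective _ hkey, Finset.card_univ, hn]
  let e := (Finset.univ.image key).orderIsoOfFin hc
  have he : ∀ i, ∃ a, key a = e i := fun i => by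
    obtain ⟨a, -, ha⟩ := Finset.mem_image.1 (e i).2
    exact ⟨a, ha⟩
  choose p hp using he
  have hlt : ∀ i j, i < j → key (p i) < key (p j) := fun i j hij => by
    rw [hp, hp]
    exact e.strictMono hij
  have hinj : Function.Injective p := fun i j hij =>
    e.injective (Subtype.ext (by rw [← hp, ← hp, hij]))
  have hbij : Function.Bijective p :=
    (Fintype.bijective_iff_injective_and_card p).2 ⟨hinj, by simp [hn]⟩
  exact ⟨(Equiv.ofBijective p hbij).symm, hlt⟩

theorem sorting_equiv_unique {L : Type*} [LinearOrder L] {key : α → L} {π ρ : α ≃ Fin n}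
    (hπ : ∀ i j, i < j → key (π.symm i) < key (π.symm j))
    (hρ : ∀ i j, i < j → key (ρ.symm i) < key (ρ.symm j)) : π = ρ := by
  have hπ' : StrictMono (key ∘ π.symm) := fun i j => hπ i j
  have hρ' : StrictMono (key ∘ ρ.symm) := fun i j => hρ i j
  have hmono : StrictMono (fun i => ρ (π.symm i)) := fun i j hij => by
    rw [← hρ'.lt_iff_lt]
    simpa using hπ i j hij
  have hsurj : Function.Surjective (fun i => ρ (π.symm i)) := (π.symm.trans ρ).surjective
  have hid : hmono.orderIsoOfSurjective _ hsurj = OrderIso.refl _ := Subsingleton.elim _ _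
  ext a
  have := congrArg (fun e : Fin n ≃o Fin n => e (π a)) hid
  simp at this
  rw [this]

theorem eq_of_monotone_of_card_fiber_eq {f g : Fin n → ℕ} (hf : Monotone f) (hg : Monotone g)
    (h : ∀ m, (Finset.univ.filter fun i => f i = m).card =
      (Finset.univ.filter fun i => g i = m).card) : f = g := by
  have hsum : ∀ (p : Fin n → ℕ) (m : ℕ), (Finset.univ.filter fun i => p i < m).card =
      ∑ v ∈ Finset.range m, (Finset.univ.filter fun i => p i = v).card := by
    intro p m
    rw [Finset.card_eq_sum_card_fiberwise (f := p) (t := Finset.range m)]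
    · refine Finset.sum_congr rfl fun v hv => ?_
      congr 1
      ext i
      have := Finset.mem_range.1 hv
      simp only [Finset.mem_filter, Finset.mem_univ, true_and]
      omega
    · intro i hi
      simpa using hi
  ext i
  have key : ∀ m, f i < m ↔ g i < m := fun m => by
    rw [← Tuple.lt_card_lt_iff_apply_lt_of_monotone hf,
      ← Tuple.lt_card_lt_iff_apply_lt_of_monotone hg, hsum, hsum]
    simp_rw [h]
  have h1 := (key (f i + 1)).1 (by omega)
  have h2 := (key (g i + 1)).2 (by omega)
  omega

/-- The monotone step function on positions that increases exactly after the positions in `S`. -/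
def cutFn (S : Finset ℕ) (i : ℕ) : ℕ := 1 + (S.filter (· < i)).card

theorem cutFn_mono (S : Finset ℕ) : Monotone (cutFn S) := fun i j hij =>
  Nat.add_le_add_left (Finset.card_le_card fun x hx => by
    simp only [Finset.mem_filter] at hx ⊢
    exact ⟨hx.1, by omega⟩) 1

theorem cutFn_lt {S : Finset ℕ} {i j k : ℕ} (hk : k ∈ S) (hik : i ≤ k) (hkj : k < j) :
    cutFn S i < cutFn S j :=
  Nat.add_lt_add_left (Finset.card_lt_card ⟨fun x hx => by
    simp only [Finset.mem_filter] at hx ⊢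
    exact ⟨hx.1, by omega⟩, fun hsub => by
    have := hsub (Finset.mem_filter.2 ⟨hk, hkj⟩)
    simp only [Finset.mem_filter] at this
    omega⟩) 1

theorem cutFn_succ {S : Finset ℕ} {i : ℕ} (hi : i ∉ S) : cutFn S (i + 1) = cutFn S i := by
  unfold cutFn
  congr 2
  ext x
  simp only [Finset.mem_filter]
  constructor
  · rintro ⟨hx, hlt⟩
    refine ⟨hx, lt_of_le_of_ne (by omega) ?_⟩
    rintro rfl
    exact hi hx
  · rintro ⟨hx, hlt⟩
    exact ⟨hx, by omega⟩

/-- The weight whose part sizes are the lengths of the blocks of `{0, …, n - 1}` cut at `S`. -/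
noncomputable def cutWeight (n : ℕ) (S : Finset ℕ) : ℕ →₀ ℕ :=
  Finsupp.onFinset (Finset.univ.image fun i : Fin n => cutFn S i)
    (fun m => (Finset.univ.filter fun i : Fin n => cutFn S i = m).card) fun m hm => by
      obtain ⟨i, hi⟩ := Finset.card_pos.1 (Nat.pos_of_ne_zero hm)
      exact Finset.mem_image.2 ⟨i, Finset.mem_univ _, (Finset.mem_filter.1 hi).2⟩

/-- The (zero-based) descent set of the linear ordering `π` with respect to the labels `ω`. -/
def descents (ω : α → ℕ) (π : α ≃ Fin n) : Finset ℕ :=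
  (Finset.range n).filter fun i => ∃ h : i + 1 < n,
    ω (π.symm ⟨i + 1, h⟩) < ω (π.symm ⟨i, Nat.lt_of_succ_lt h⟩)

theorem mem_descents {ω : α → ℕ} {π : α ≃ Fin n} {i : ℕ} :
    i ∈ descents ω π ↔ ∃ h : i + 1 < n,
      ω (π.symm ⟨i + 1, h⟩) < ω (π.symm ⟨i, Nat.lt_of_succ_lt h⟩) := by
  rw [descents, Finset.mem_filter, Finset.mem_range, and_iff_right_iff_imp]
  rintro ⟨h, -⟩
  omega

theorem lt_of_cutFn_eq {ω : α → ℕ} (hω : Function.Injective ω) {π : α ≃ Fin n} {S : Finset ℕ}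
    (hS : descents ω π ⊆ S) {i j : Fin n} (hij : i < j) (he : cutFn S i = cutFn S j) :
    ω (π.symm i) < ω (π.symm j) := by
  obtain ⟨i, hi⟩ := i
  obtain ⟨j, hj⟩ := j
  simp only [Fin.mk_lt_mk] at hij he
  induction j, hij using Nat.le_induction with
  | base =>
    by_contra hlt
    have hne : ω (π.symm ⟨i + 1, hj⟩) ≠ ω (π.symm ⟨i, hi⟩) := fun h => by
      have := π.symm.injective (hω h)
      simp at this
    exact (cutFn_lt (hS (mem_descents.2 ⟨hj, lt_of_le_of_ne (not_lt.1 hlt) hne⟩))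
      le_rfl (Nat.lt_succ_self i)).ne he
  | succ j hij ih =>
    have hij' : i ≤ j := by omega
    have h1 : cutFn S i = cutFn S j :=
      le_antisymm (cutFn_mono S hij') (he ▸ cutFn_mono S (Nat.le_succ j))
    refine (ih (by omega) h1).trans ?_
    by_contra hlt
    have hne : ω (π.symm ⟨j + 1, hj⟩) ≠ ω (π.symm ⟨j, by omega⟩) := fun h => by
      have := π.symm.injective (hω h)
      simp at this
    exact (cutFn_lt (hS (mem_descents.2 ⟨hj, lt_of_le_of_ne (not_lt.1 hlt) hne⟩))
      le_rfl (Nat.lt_succ_self j)).ne (h1 ▸ he)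

end LinearExtension

section Counting

variable {α : Type*} [PartialOrder α] {n : ℕ}

/-- The linear extensions of `α` whose descent set satisfies `p`. -/
def linExt (ω : α → ℕ) (n : ℕ) (p : Finset ℕ → Prop) : Set (α ≃ Fin n) :=
  {π | Monotone π ∧ p (descents ω π)}

theorem mem_linExt {ω : α → ℕ} {p : Finset ℕ → Prop} {π : α ≃ Fin n} :
    π ∈ linExt ω n p ↔ Monotone π ∧ p (descents ω π) := Iff.rfl

variable [Fintype α]

theorem ptnCount_cutWeight (hn : Fintype.card α = n) {ω : α → ℕ} (hω : Function.Injective ω)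
    (S : Finset ℕ) : ptnCount ω (cutWeight n S) = (linExt ω n (· ⊆ S)).ncard := by
  classical
  let Φ : (α ≃ Fin n) → α → ℕ := fun π a => cutFn S (π a)
  have hkey : ∀ f : α → ℕ, Function.Injective fun a => toLex (f a, ω a) := fun f a b hab =>
    hω (Prod.ext_iff.1 (toLex.injective hab)).2
  have hsorts : ∀ π ∈ linExt ω n (· ⊆ S), ∀ i j, i < j →
      toLex (Φ π (π.symm i), ω (π.symm i)) < toLex (Φ π (π.symm j), ω (π.symm j)) := by
    intro π hπ i j hij
    rw [Prod.Lex.toLex_lt_toLex]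
    simp only [Φ, Equiv.apply_symm_apply]
    rcases (cutFn_mono S hij.le).lt_or_eq with h | h
    · exact Or.inl h
    · exact Or.inr ⟨h, lt_of_cutFn_eq hω hπ.2 hij h⟩
  have hinj : Set.InjOn Φ (linExt ω n (· ⊆ S)) := fun π hπ ρ hρ he =>
    sorting_equiv_unique (key := fun a => toLex (Φ π a, ω a)) (hsorts π hπ) (he ▸ hsorts ρ hρ)
  have hcard : ∀ (π : α ≃ Fin n) (f : α → ℕ) (m : ℕ), (f ⁻¹' {m}).ncard =
      (Finset.univ.filter fun i => f (π.symm i) = m).card := by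
    intro π f m
    rw [← Set.ncard_image_of_injective _ π.injective, ← Set.ncard_coe_finset]
    congr 1
    ext i
    simp [Equiv.image_eq_preimage_symm]
  rw [ptnCount, ← hinj.ncard_image]
  congr 1
  ext f
  constructor
  · rintro ⟨⟨h1, hmono, hstrict⟩, hw⟩
    obtain ⟨π, hπ⟩ := exists_sorting_equiv hn (hkey f)
    have hfπ : Monotone (fun i => f (π.symm i)) := monotone_iff_forall_lt.2 fun i j hij => by
      rcases Prod.Lex.toLex_lt_toLex.1 (hπ i j hij) with h | h
      · exact h.le
      · exact h.1.le
    have heq : (fun i => f (π.symm i)) = fun i : Fin n => cutFn S i := by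
      refine eq_of_monotone_of_card_fiber_eq hfπ (fun i j hij => cutFn_mono S hij) fun m => ?_
      rcases Nat.eq_zero_or_pos m with rfl | hm
      · rw [Finset.filter_false_of_mem, Finset.filter_false_of_mem]
        · intro i _
          simp [cutFn]
        · intro i _
          have := h1 (π.symm i)
          omega
      · rw [← hcard, hw m hm]
        rfl
    refine ⟨π, ⟨?_, ?_⟩, ?_⟩
    · refine monotone_iff_forall_lt.2 fun a b hab => ?_
      by_contra hlt
      have := hπ _ _ (not_le.1 hlt)
      simp only [Equiv.symm_apply_apply, Prod.Lex.toLex_lt_toLex] at this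
      rcases this with h | ⟨h, h'⟩
      · exact absurd (hmono a b hab.le) (not_le.2 h)
      · exact (hstrict a b hab.le h').ne h.symm
    · intro i hi
      obtain ⟨hi1, hlt⟩ := mem_descents.1 hi
      by_contra hiS
      have h2 := hπ ⟨i, Nat.lt_of_succ_lt hi1⟩ ⟨i + 1, hi1⟩ (Fin.mk_lt_mk.2 (Nat.lt_succ_self i))
      rw [Prod.Lex.toLex_lt_toLex] at h2
      have e1 := congrFun heq ⟨i, Nat.lt_of_succ_lt hi1⟩
      have e2 := congrFun heq ⟨i + 1, hi1⟩
      have e3 := cutFn_succ hiS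
      simp only at e1 e2 h2
      omega
    · ext a
      simpa using (congrFun heq (π a)).symm
  · rintro ⟨π, ⟨hπ, hS⟩, rfl⟩
    refine ⟨⟨fun a => by simp [Φ, cutFn], fun a b hab => cutFn_mono S (hπ hab), ?_⟩, ?_⟩
    · intro a b hab hba
      have hle : cutFn S (π a) ≤ cutFn S (π b) := cutFn_mono S (hπ hab)
      refine lt_of_le_of_ne hle fun he => ?_
      have hne : π a < π b := lt_of_le_of_ne (hπ hab) fun h => by
        rw [π.injective h] at hba
        exact lt_irrefl _ hba
      have := lt_of_cutFn_eq hω hS hne he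
      simp only [Equiv.symm_apply_apply] at this
      exact lt_asymm this hba
    · intro m _
      rw [hcard π]
      simp [Φ, cutWeight]

theorem ncard_linExt_subset (ω : α → ℕ) (S : Finset ℕ) :
    (linExt ω n (· ⊆ S)).ncard = ∑ T ∈ S.powerset, (linExt ω n (· = T)).ncard := by
  classical
  have hfin : ∀ p, (linExt ω n p).ncard =
      (Finset.univ.filter fun π : α ≃ Fin n => π ∈ linExt ω n p).card := fun p => by
    rw [← Set.ncard_coe_finset]
    congr 1
    ext π
    simp
  rw [hfin, Finset.card_eq_sum_card_fiberwise (f := descents ω) (t := S.powerset)]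
  · refine Finset.sum_congr rfl fun T hT => ?_
    rw [hfin]
    congr 1
    ext π
    simp only [Finset.mem_filter, Finset.mem_univ, true_and, mem_linExt]
    constructor
    · rintro ⟨⟨h1, -⟩, h2⟩
      exact ⟨h1, h2⟩
    · rintro ⟨h1, h2⟩
      exact ⟨⟨h1, h2 ▸ Finset.mem_powerset.1 hT⟩, h2⟩
  · intro π hπ
    rw [Finset.mem_coe, Finset.mem_filter, mem_linExt] at hπ
    exact Finset.mem_coe.2 (Finset.mem_powerset.2 hπ.2.2)

theorem ncard_linExt_eq_of_kEq {β : Type*} [PartialOrder β] [Fintype β] {ω : α → ℕ} {τ : β → ℕ}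
    (hα : Fintype.card α = n) (hβ : Fintype.card β = n)
    (hω : Function.Injective ω) (hτ : Function.Injective τ) (h : KEq ω τ) (T : Finset ℕ) :
    (linExt ω n (· = T)).ncard = (linExt τ n (· = T)).ncard := by
  classical
  induction T using Finset.strongInduction with
  | H T ih =>
    have hT := h (cutWeight n T)
    rw [ptnCount_cutWeight hα hω, ptnCount_cutWeight hβ hτ, ncard_linExt_subset,
      ncard_linExt_subset, ← Finset.add_sum_erase _ _ (Finset.mem_powerset_self T),
      ← Finset.add_sum_erase _ _ (Finset.mem_powerset_self T)] at hT
    have : ∑ U ∈ T.powerset.erase T, (linExt ω n (· = U)).ncard =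
        ∑ U ∈ T.powerset.erase T, (linExt τ n (· = U)).ncard :=
      Finset.sum_congr rfl fun U hU => by
        rw [Finset.mem_erase, Finset.mem_powerset] at hU
        exact ih U (Finset.ssubset_iff_subset_ne.2 ⟨hU.2, hU.1⟩)
    omega

end Counting

section Strict

variable {α : Type*} [PartialOrder α] [Fintype α] {n : ℕ}

theorem exists_Ico_of_ordConnected {s : Set (Fin n)} (hs : s.OrdConnected) :
    ∃ i, i + s.ncard ≤ n ∧ ∀ x : Fin n, i ≤ x → (x : ℕ) < i + s.ncard → x ∈ s := by
  classical
  rcases s.eq_empty_or_nonempty with rfl | hne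
  · exact ⟨0, by simp, fun x _ hx => by simp at hx⟩
  · obtain ⟨a, ha, hamin⟩ := s.toFinite.exists_minimal hne
    obtain ⟨b, hb, hbmax⟩ := s.toFinite.exists_maximal hne
    have hsab : s = Set.Icc a b := by
      ext x
      refine ⟨fun hx => ⟨?_, ?_⟩, fun hx => hs.out ha hb hx⟩
      · exact (le_total a x).elim id (hamin hx)
      · exact (le_total x b).elim id (hbmax hx)
    have hab : a ≤ b := (hsab ▸ ha : a ∈ Set.Icc a b).2
    have hc : s.ncard = b + 1 - a := by
      rw [hsab, ← Finset.coe_Icc, Set.ncard_coe_finset, Fin.card_Icc]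
    have hab' : (a : ℕ) ≤ b := hab
    refine ⟨a, ?_, fun x hax hxb => ?_⟩
    · have := b.2
      omega
    · rw [hsab]
      exact ⟨hax, Fin.le_def.2 (by omega)⟩

theorem exists_strict_convex_iff (hn : Fintype.card α = n) {ω : α → ℕ}
    (hω : Function.Injective ω) (k : ℕ) :
    (∃ s : Set α, s.OrdConnected ∧ (∀ a ∈ s, ∀ b ∈ s, a ⋖ b → ω b < ω a) ∧ s.ncard = k) ↔
      ∃ (T : Finset ℕ) (i : ℕ), i + k ≤ n ∧ (∀ j, i ≤ j → j + 1 < i + k → j ∈ T) ∧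
        (linExt ω n (· = T)).ncard ≠ 0 := by
  constructor
  · rintro ⟨s, hs, hcov, rfl⟩
    obtain ⟨f, m, -, -, hmono, hstrict, rfl⟩ := exists_monotone_fiber_eq hs
    have hkey : Function.Injective fun a => toLex (f a, OrderDual.toDual (ω a)) := fun a b hab =>
      hω (OrderDual.toDual.injective (Prod.ext_iff.1 (toLex.injective hab)).2)
    obtain ⟨π, hπ⟩ := exists_sorting_equiv hn hkey
    simp only [Prod.Lex.toLex_lt_toLex, OrderDual.toDual_lt_toDual] at hπ
    have hfπ : Monotone (fun i => f (π.symm i)) := monotone_iff_forall_lt.2 fun i j hij => by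
      rcases hπ i j hij with h | h
      · exact h.le
      · exact h.1.le
    have hπmono : Monotone π := monotone_iff_forall_lt.2 fun a b hab => by
      by_contra hlt
      have := hπ _ _ (not_le.1 hlt)
      simp only [Equiv.symm_apply_apply] at this
      rcases this with h | ⟨h, h'⟩
      · exact absurd (hmono a b hab.le) (not_le.2 h)
      · obtain ⟨ha, hb⟩ := hstrict a b hab h.symm
        exact lt_asymm h' (rel_of_lt_of_rel_covBy (R := fun a b => ω b < ω a)
          (fun _ _ _ h₁ h₂ => h₂.trans h₁) hs hcov ha hb hab)
    have hconn : ((fun i => f (π.symm i)) ⁻¹' {m}).OrdConnected :=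
      Set.ordConnected_singleton.preimage_mono hfπ
    have hcard : ((fun i => f (π.symm i)) ⁻¹' {m}).ncard = (f ⁻¹' {m}).ncard := by
      rw [← Set.ncard_image_of_injective (f ⁻¹' {m}) π.injective, Equiv.image_eq_preimage_symm]
      rfl
    obtain ⟨i, hin, hi⟩ := exists_Ico_of_ordConnected hconn
    rw [hcard] at hin hi
    refine ⟨descents ω π, i, hin, fun j hij hj => mem_descents.2 ⟨by omega, ?_⟩, ?_⟩
    · have h1 : f _ = m := hi ⟨j, by omega⟩ hij (by simp only; omega)
      have h2 : f _ = m := hi ⟨j + 1, by omega⟩ (by simp only; omega) hj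
      rcases hπ ⟨j, by omega⟩ ⟨j + 1, by omega⟩ (Fin.mk_lt_mk.2 (Nat.lt_succ_self j)) with h | h
      · omega
      · exact h.2
    · rw [← Nat.pos_iff_ne_zero, Set.ncard_pos (Set.toFinite _)]
      exact ⟨π, hπmono, rfl⟩
  · rintro ⟨T, i, hik, hT, hne⟩
    obtain ⟨π, hπ, rfl⟩ := Set.nonempty_of_ncard_ne_zero hne
    set I : Set (Fin n) := {x | i ≤ (x : ℕ) ∧ (x : ℕ) < i + k} with hI
    have hdesc : ∀ x y : ℕ, (hx : i ≤ x) → (hxy : x < y) → (hy : y < i + k) →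
        ω (π.symm ⟨y, by omega⟩) < ω (π.symm ⟨x, by omega⟩) := by
      intro x y hx hxy hy
      induction y, hxy using Nat.le_induction with
      | base => exact (mem_descents.1 (hT x hx hy)).2
      | succ y hxy ih =>
        exact ((mem_descents.1 (hT y (by omega) hy)).2).trans (ih (by omega))
    refine ⟨π ⁻¹' I, ?_, ?_, ?_⟩
    · refine Set.OrdConnected.preimage_mono (f := π) ⟨?_⟩ hπ
      rintro x ⟨hx, -⟩ y ⟨-, hy⟩ z ⟨hxz, hzy⟩
      rw [Fin.le_def] at hxz hzy
      exact ⟨by omega, by omega⟩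
    · intro a ha b hb hab
      have hlt : π a < π b := (hπ hab.le).lt_of_ne fun h => hab.ne (π.injective h)
      simpa using hdesc _ _ ha.1 hlt hb.2
    · rw [← Set.ncard_image_of_injective _ π.injective, Set.image_preimage_eq _ π.surjective]
      have : Set.image Fin.val I = ↑(Finset.Ico i (i + k)) := by
        ext x
        simp only [hI, Set.mem_image, Set.mem_ofPred_eq, Finset.coe_Ico, Set.mem_Ico]
        constructor
        · rintro ⟨y, hy, rfl⟩
          exact hy
        · intro hx
          exact ⟨⟨x, by omega⟩, hx, rfl⟩
      rw [← Set.ncard_image_of_injective _ Fin.val_injective, this, Set.ncard_coe_finset,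
        Nat.card_Ico]
      omega

end Strict

/-- If `(P,ω) ~ (Q,τ)`, then the sizes of the largest weak (resp. strict) convex subposets
of `(P,ω)` and `(Q,τ)` are the same. -/
theorem stmt10 {α β : Type*} [PartialOrder α] [Fintype α] [PartialOrder β] [Fintype β]
    (ω : α → ℕ) (τ : β → ℕ) (hω : IsLabeling ω) (hτ : IsLabeling τ)
    (h : KEq ω τ) :
    maxWeakConvex ω = maxWeakConvex τ ∧ maxStrictConvex ω = maxStrictConvex τ := by
  have hωi : Function.Injective ω := Set.injOn_univ.1 hω.injOn
  have hτi : Function.Injective τ := Set.injOn_univ.1 hτ.injOn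
  constructor
  · unfold maxWeakConvex
    simp only [exists_weak_convex_iff hωi, exists_weak_convex_iff hτi, h _]
  · have hcard := card_eq_of_kEq h
    unfold maxStrictConvex
    simp only [exists_strict_convex_iff hcard hωi, exists_strict_convex_iff rfl hτi,
      ncard_linExt_eq_of_kEq hcard rfl hωi hτi h]
end
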